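/- arXiv:quant-ph/0506180 — 7 statements merged into one kernel-verified Lean document; each statement's English description precedes it below -/
import Mathlib

section
/- Let n ≥ 1. Let β, γ : Fin n → ZMod 2, and suppose b, c : Fin n → Fin n → ZMod 2 satisfy b i j + c i j = β i * γ j for all i ≠ j (this is the constraint satisfied by the outputs of a PR box shared between parties i and j into which party i inputs β i and party j inputs γ j). Define r : Fin n → ZMod 2 by r 0 = 1 and r i = 0 for i ≠ 0, and define the outputs a : Fin n → ZMod 2 by a i = (∑ j ≠ i, (b i j + c j i)) + β i * γ i + r i. Then ∑ i, a i = (∑ i, β i) * (∑ i, γ i) + 1; that is, the sum of the outputs equals NAND(∑ i β i, ∑ i γ i). -/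
/-- The parity identity underlying the NAND building block of Theorem 1:
if PR boxes shared between each ordered pair of parties produce outputs
`b i j` (for party `i`, input `β i`) and `c i j` (for party `j`, input `γ j`)
with `b i j + c i j = β i * γ j`, then the outputs
`a i = (∑ j ≠ i, (b i j + c j i)) + β i * γ i + r i` sum to
`NAND(∑ i, β i, ∑ i, γ i) = (∑ i, β i) * (∑ i, γ i) + 1`. -/
theorem pr_boxes_nand_parity (n : ℕ) (hn : 1 ≤ n)
    (β γ : Fin n → ZMod 2) (b c : Fin n → Fin n → ZMod 2)
    (hbc : ∀ i j : Fin n, i ≠ j → b i j + c i j = β i * γ j)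
    (r : Fin n → ZMod 2)
    (hr0 : r ⟨0, hn⟩ = 1) (hr : ∀ i : Fin n, i ≠ ⟨0, hn⟩ → r i = 0)
    (a : Fin n → ZMod 2)
    (ha : ∀ i : Fin n,
      a i = (∑ j ∈ Finset.univ.erase i, (b i j + c j i)) + β i * γ i + r i) :
    ∑ i, a i = (∑ i, β i) * (∑ i, γ i) + 1 := by
  have hrs : ∑ i, r i = 1 := by
    rw [Finset.sum_eq_single (⟨0, hn⟩ : Fin n) (fun i _ h => hr i h) (by simp), hr0]
  have hswap : ∑ i, ∑ j ∈ Finset.univ.erase i, c j i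
      = ∑ i, ∑ j ∈ Finset.univ.erase i, c i j := by
    apply Finset.sum_comm'
    intro x y
    simp [eq_comm]
  have hmain : ∑ i, ∑ j ∈ Finset.univ.erase i, (b i j + c j i)
      = ∑ i, ∑ j ∈ Finset.univ.erase i, β i * γ j := by
    simp only [Finset.sum_add_distrib]
    rw [hswap]
    simp only [← Finset.sum_add_distrib]
    refine Finset.sum_congr rfl fun i _ => Finset.sum_congr rfl fun j hj => ?_
    exact hbc i j (Finset.ne_of_mem_erase hj).symm
  simp only [ha]
  rw [Finset.sum_add_distrib, Finset.sum_add_distrib, hrs, hmain,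
    ← Finset.sum_add_distrib, Finset.sum_mul_sum]
  congr 1
  refine Finset.sum_congr rfl fun i _ => ?_
  exact Finset.sum_erase_add _ (fun j => β i * γ j) (Finset.mem_univ i)
end

section
/- Let n ≥ 2, and fix β, γ : Fin n → ZMod 2. Let b : Fin n → Fin n → ZMod 2 be chosen uniformly at random (i.e., according to the uniform probability mass function on the finite type Fin n → Fin n → ZMod 2). Define c i j = b i j + β i * γ j, define r : Fin n → ZMod 2 by r 0 = 1 and r i = 0 for i ≠ 0, and define a i = (∑ j ≠ i, (b i j + c j i)) + β i * γ i + r i. Then for every t : Fin n → ZMod 2 with ∑ i, t i = (∑ i, β i) * (∑ i, γ i) + 1, the probability that a = t equals 1/2^(n-1). In other words, the random output string a is uniformly distributed on the affine subspace of strings whose coordinates sum to NAND(∑ β i, ∑ γ i). -/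
theorem aux_twice (x : ZMod 2) : x + x = 0 := CharTwo.add_self_eq_zero x

/-- even-weight vector from its tail -/
def evenU {m : ℕ} (v : Fin m → ZMod 2) : Fin (m+1) → ZMod 2 := Fin.cons (∑ i, v i) v

theorem evenU_sum {m : ℕ} (v : Fin m → ZMod 2) : ∑ i, evenU v i = 0 := by
  simp [evenU, Fin.sum_univ_succ, aux_twice]

theorem evenU_tail {m : ℕ} (u : Fin (m+1) → ZMod 2) (h : ∑ i, u i = 0) :
    evenU (fun i => u i.succ) = u := by
  rw [Fin.sum_univ_succ] at h
  funext i
  refine Fin.cases ?_ (fun i => ?_) i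
  · simp only [evenU, Fin.cons_zero]
    exact (CharTwo.add_eq_zero.mp h).symm
  · simp [evenU]

/-- shift matrix -/
def shiftE {m : ℕ} (v : Fin m → ZMod 2) : Fin (m+1) → Fin (m+1) → ZMod 2 :=
  fun i j => if j = 0 then evenU v i else 0

theorem aux_card (m : ℕ) (d t : Fin (m+1) → ZMod 2)
    (a : (Fin (m+1) → Fin (m+1) → ZMod 2) → Fin (m+1) → ZMod 2)
    (ha : ∀ b i, a b i = (∑ j, b i j + ∑ j, b j i) + d i)
    (ht : ∑ i, t i = ∑ i, d i) :
    Nat.card {b | a b = t} * 2 ^ m = Nat.card (Fin (m+1) → Fin (m+1) → ZMod 2) := by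
  have hs : ∀ b v i, a (b + shiftE v) i = a b i + evenU v i := by
    intro b v i
    have h1 : ∑ j, shiftE v i j = evenU v i := by simp [shiftE]
    have h2 : ∑ j, shiftE v j i = 0 := by
      by_cases h : i = 0 <;> simp [shiftE, h, evenU_sum]
    rw [ha, ha]
    simp only [Pi.add_apply, Finset.sum_add_distrib, h1, h2]
    ring
  have hsum : ∀ b, ∑ i, (a b i + t i) = 0 := by
    intro b
    simp only [ha, Finset.sum_add_distrib, ht]
    rw [Finset.sum_comm (f := fun i j => b j i), aux_twice, zero_add, aux_twice]
  have hE : ∀ v : Fin m → ZMod 2, shiftE v + shiftE v = 0 := by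
    intro v; funext i j; exact aux_twice _
  let e : ({b | a b = t} × (Fin m → ZMod 2)) ≃ (Fin (m+1) → Fin (m+1) → ZMod 2) :=
    { toFun := fun p => p.1.1 + shiftE p.2
      invFun := fun b => (⟨b + shiftE (fun i => a b i.succ + t i.succ), by
        funext i
        rw [hs, evenU_tail (fun i => a b i + t i) (hsum b), ← add_assoc, aux_twice, zero_add]⟩,
        fun i => a b i.succ + t i.succ)
      left_inv := by
        rintro ⟨⟨b, hb⟩, v⟩
        have hb' : a b = t := hb
        have hv : (fun i : Fin m => a (b + shiftE v) i.succ + t i.succ) = v := by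
          funext i
          rw [hs, hb', add_right_comm, aux_twice, zero_add]
          simp [evenU]
        ext1
        · apply Subtype.ext
          simp only [hv]
          rw [add_assoc, hE, add_zero]
        · exact hv
      right_inv := by
        intro b
        simp only
        rw [add_assoc, hE, add_zero] }
  rw [← Nat.card_congr e, Nat.card_prod]
  simp

/-- The NAND building block reproduces the full output distribution of a
full-correlation box: if the PR-box outputs `b i j` are drawn uniformly at random
and `c i j = b i j + β i * γ j`, then the output string
`a i = (∑ j ≠ i, (b i j + c j i)) + β i * γ i + r i` is uniformly distributed over
the strings summing to `NAND(∑ i, β i, ∑ i, γ i)`: each such target string `t`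
occurs with probability `1 / 2 ^ (n - 1)`. -/
theorem nand_block_uniform_output (n : ℕ) (hn : 2 ≤ n)
    (β γ : Fin n → ZMod 2)
    (c : (Fin n → Fin n → ZMod 2) → Fin n → Fin n → ZMod 2)
    (hc : ∀ b i j, c b i j = b i j + β i * γ j)
    (r : Fin n → ZMod 2)
    (hr0 : r ⟨0, by omega⟩ = 1) (hr : ∀ i : Fin n, i ≠ ⟨0, by omega⟩ → r i = 0)
    (a : (Fin n → Fin n → ZMod 2) → Fin n → ZMod 2)
    (ha : ∀ b i,
      a b i = (∑ j ∈ Finset.univ.erase i, (b i j + c b j i)) + β i * γ i + r i)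
    (t : Fin n → ZMod 2)
    (ht : ∑ i, t i = (∑ i, β i) * (∑ i, γ i) + 1) :
    (PMF.uniformOfFintype (Fin n → Fin n → ZMod 2)).toOuterMeasure {b | a b = t}
      = 1 / 2 ^ (n - 1) := by
  obtain ⟨m, rfl⟩ : ∃ m, n = m + 1 := ⟨n - 1, by omega⟩
  have hrs : ∑ i, r i = 1 := by
    rw [Finset.sum_eq_single (⟨0, by omega⟩ : Fin (m+1)) (fun i _ h => hr i h) (by simp), hr0]
  have key := aux_card m (fun i => (∑ j, β j) * γ i + r i) t a (by
    intro b i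
    rw [ha]
    simp only [hc]
    have h := Finset.add_sum_erase Finset.univ (fun j => b i j + (b j i + β j * γ i))
      (Finset.mem_univ i)
    rw [← add_assoc (b i i) (b i i), aux_twice, zero_add] at h
    rw [add_comm (Finset.sum _ _) (β i * γ i), h]
    simp only [Finset.sum_add_distrib, Finset.sum_mul]
    ring) (by
    rw [ht, Finset.sum_add_distrib, hrs, Finset.mul_sum])
  classical
  rw [PMF.toOuterMeasure_uniformOfFintype_apply]
  rw [← Nat.card_eq_fintype_card, ← Nat.card_eq_fintype_card, ← key]
  have hpos : Nat.card {b | a b = t} ≠ 0 := by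
    intro h0
    rw [h0, zero_mul] at key
    exact Nat.card_pos.ne key
  push_cast
  have hc0 : (Nat.card {b | a b = t} : ENNReal) ≠ 0 := by exact_mod_cast hpos
  have h := ENNReal.mul_div_mul_left (1 : ENNReal) (2 ^ m) hc0 (ENNReal.natCast_ne_top _)
  rw [mul_one] at h
  exact h
end

section
/- Let n ≥ 2 and let X i (i : Fin n) be nonempty finite input sets. Let P(a | x) (with a : Fin n → ZMod 2 and x : Π i, X i) be an n-partite box, i.e., P(a | x) ≥ 0 and ∑_a P(a | x) = 1 for every x. Suppose that for every subset S ⊆ Fin n of size n − 1, every input x, and every partial assignment t, the marginal probability ∑_{a : ∀ i ∈ S, a i = t i} P(a | x) equals 1/2^(n-1) (i.e., the outputs of any n − 1 of the parties are completely random, independently of all inputs). Then P is a convex combination of full-correlation boxes: there exist a finite index set J, weights p : J → ℝ with p j ≥ 0 and ∑ j, p j = 1, and functions g j : (Π i, X i) → ZMod 2 such that P(a | x) = ∑ j, p j * (if ∑ i, a i = g j x then 1/2^(n-1) else 0) for all a and x. -/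
theorem mix_aux {Y : Type} [Fintype Y] [DecidableEq Y] (q : Y → ZMod 2 → ℝ)
    (hq1 : ∀ y, ∑ v, q y v = 1) (y : Y) (s : ZMod 2) :
    ∑ g : Y → ZMod 2, (∏ x, q x (g x)) * (if s = g y then 1 else 0) = q y s := by
  have h1 : ∀ g : Y → ZMod 2, (∏ x, q x (g x)) * (if s = g y then (1:ℝ) else 0)
      = ∏ x, (q x (g x) * (if x = y then (if s = g x then 1 else 0) else 1)) := by
    intro g
    rw [Finset.prod_mul_distrib, Finset.prod_ite_eq' Finset.univ y]
    simp
  have h2 := Finset.prod_univ_sum (fun _ : Y => (Finset.univ : Finset (ZMod 2)))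
    (fun x v => q x v * (if x = y then (if s = v then 1 else 0) else 1))
  rw [Fintype.piFinset_univ] at h2
  rw [Finset.sum_congr rfl (fun g _ => h1 g), ← h2, Finset.prod_eq_single y]
  · simp
  · intro b _ hb
    simp [hb, hq1]
  · simp

theorem flip_aux (n : ℕ) (F : (Fin n → ZMod 2) → ℝ) (c : ℝ)
    (hF : ∀ S : Finset (Fin n), S.card = n - 1 → ∀ t : Fin n → ZMod 2,
      ∑ a ∈ Finset.univ.filter (fun a : Fin n → ZMod 2 => ∀ i ∈ S, a i = t i), F a = c)
    (i : Fin n) (a : Fin n → ZMod 2) : F a + F (a + Pi.single i 1) = c := by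
  have h := hF (Finset.univ.erase i) (by simp) a
  have h3 : a ≠ a + Pi.single i 1 := by
    intro h
    have := congrFun h i
    simp at this
  have h2 : Finset.univ.filter (fun b : Fin n → ZMod 2 => ∀ j ∈ Finset.univ.erase i, b j = a j)
      = {a, a + Pi.single i 1} := by
    ext b
    simp only [Finset.mem_filter, Finset.mem_univ, true_and, Finset.mem_erase, and_true,
      Finset.mem_insert, Finset.mem_singleton]
    constructor
    · intro hb
      have key : ∀ u v : ZMod 2, u = v ∨ u = v + 1 := by decide
      rcases key (b i) (a i) with h | h
      · left
        ext j
        by_cases hj : j = i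
        · subst hj; rw [h]
        · rw [hb j hj]
      · right
        funext j
        by_cases hj : j = i
        · subst hj; simpa using h
        · simpa [hj] using hb j hj
    · rintro (rfl | rfl) j hj
      · rfl
      · simp [hj]
  rw [h2, Finset.sum_pair h3] at h
  exact h

theorem parity_aux (n : ℕ) (F : (Fin n → ZMod 2) → ℝ) (c : ℝ)
    (hF : ∀ (i : Fin n) (a : Fin n → ZMod 2), F a + F (a + Pi.single i 1) = c)
    (a : Fin n → ZMod 2) : F a = if ∑ i, a i = 0 then F 0 else c - F 0 := by
  have key : ∀ S : Finset (Fin n), F (∑ i ∈ S, Pi.single i (a i)) =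
      if ∑ i ∈ S, a i = 0 then F 0 else c - F 0 := by
    intro S
    induction S using Finset.induction_on with
    | empty => simp
    | insert i S hi ih =>
      rw [Finset.sum_insert hi, Finset.sum_insert hi]
      have hz : ∀ u : ZMod 2, u = 0 ∨ u = 1 := by decide
      rcases hz (a i) with h | h
      · simpa [h] using ih
      · have h1 := hF i (∑ i ∈ S, Pi.single i (a i))
        rw [h, add_comm (Pi.single i 1)]
        rcases hz (∑ i ∈ S, a i) with h2 | h2
        · rw [h2] at ih ⊢
          simp at ih ⊢
          linarith
        · rw [h2] at ih ⊢
          have : (1 + 1 : ZMod 2) = 0 := by decide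
          simp [this] at ih ⊢
          linarith
  have := key Finset.univ
  rwa [Finset.univ_sum_single] at this

/-- Any `n`-partite two-output box whose marginals on every set of `n - 1`
parties are completely random (uniform, independently of all inputs) is a
convex combination of full-correlation boxes. -/
theorem box_with_random_marginals_is_mixture_of_full_correlation_boxes
    (n : ℕ) (hn : 2 ≤ n)
    (X : Fin n → Type) [∀ i, Fintype (X i)] [∀ i, Nonempty (X i)]
    (P : (Fin n → ZMod 2) → (∀ i, X i) → ℝ)
    (hpos : ∀ a x, 0 ≤ P a x)
    (hsum : ∀ x, ∑ a : Fin n → ZMod 2, P a x = 1)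
    (hmarg : ∀ S : Finset (Fin n), S.card = n - 1 →
      ∀ (x : ∀ i, X i) (t : Fin n → ZMod 2),
        ∑ a ∈ Finset.univ.filter (fun a : Fin n → ZMod 2 => ∀ i ∈ S, a i = t i),
          P a x = 1 / 2 ^ (n - 1)) :
    ∃ (m : ℕ) (p : Fin m → ℝ) (g : Fin m → (∀ i, X i) → ZMod 2),
      (∀ j, 0 ≤ p j) ∧ (∑ j, p j = 1) ∧
      ∀ (a : Fin n → ZMod 2) (x : ∀ i, X i),
        P a x = ∑ j, p j * (if ∑ i, a i = g j x then 1 / 2 ^ (n - 1) else 0) := by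
  classical
  have hflip := fun x => flip_aux n (fun a => P a x) _ (fun S hS t => hmarg S hS x t)
  have hpar := fun x => parity_aux n (fun a => P a x) _ (hflip x)
  have hc : (2:ℝ) ^ (n - 1) ≠ 0 := by positivity
  let q : (∀ i, X i) → ZMod 2 → ℝ := fun x v =>
    2 ^ (n - 1) * (if v = 0 then P 0 x else 1 / 2 ^ (n - 1) - P 0 x)
  have hq0 : ∀ x v, 0 ≤ q x v := by
    intro x v
    have h1 := hflip x ⟨0, by omega⟩ 0
    have h2 := hpos (0 + Pi.single ⟨0, by omega⟩ 1) x
    have h3 := hpos 0 x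
    refine mul_nonneg (by positivity) ?_
    split_ifs
    · exact h3
    · linarith
  have hq1 : ∀ x, ∑ v, q x v = 1 := by
    intro x
    have : ∑ v, q x v = q x 0 + q x 1 := Fin.sum_univ_two (fun v : Fin 2 => q x v)
    rw [this]
    simp only [q]
    simp
    field_simp
    ring
  let e := (Fintype.equivFin ((∀ i, X i) → ZMod 2)).symm
  refine ⟨_, fun j => ∏ x, q x (e j x), fun j => e j, ?_, ?_, ?_⟩
  · intro j
    exact Finset.prod_nonneg fun x _ => hq0 x _
  · rw [Equiv.sum_comp e (fun g => ∏ x, q x (g x))]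
    have h2 := Finset.prod_univ_sum (fun _ : (∀ i, X i) => (Finset.univ : Finset (ZMod 2))) q
    rw [Fintype.piFinset_univ] at h2
    rw [← h2]
    simp [hq1]
  · intro a x
    rw [Equiv.sum_comp e (fun g => (∏ x, q x (g x)) *
      (if ∑ i, a i = g x then (1:ℝ) / 2 ^ (n - 1) else 0))]
    have hm := mix_aux q hq1 x (∑ i, a i)
    have : ∀ g : (∀ i, X i) → ZMod 2, (∏ x, q x (g x)) *
      (if ∑ i, a i = g x then (1:ℝ) / 2 ^ (n - 1) else 0) =
      ((∏ x, q x (g x)) * (if ∑ i, a i = g x then (1:ℝ) else 0)) * (1 / 2 ^ (n - 1)) := by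
      intro g
      split_ifs <;> simp
    rw [Finset.sum_congr rfl (fun g _ => this g), ← Finset.sum_mul, hm]
    have h4 := hpar x a
    rw [h4]
    simp only [q]
    field_simp
end

section
/- Define the PR box as the function PR : ZMod 2 → ZMod 2 → ZMod 2 → ZMod 2 → ℝ given by PR a₁ a₂ x₁ x₂ = 1/2 if a₁ + a₂ = x₁ * x₂ and 0 otherwise (where x₁, x₂ are inputs and a₁, a₂ outputs). Then the PR box is nonlocal: there do not exist a finite type Λ, weights p : Λ → ℝ with p λ ≥ 0 and ∑ λ, p λ = 1, and families Q₁, Q₂ : Λ → ZMod 2 → ZMod 2 → ℝ with Q_i λ x a ≥ 0 and ∑_a Q_i λ x a = 1 for all λ and x, such that for all a₁, a₂, x₁, x₂: ∑ λ, p λ * Q₁ λ x₁ a₁ * Q₂ λ x₂ a₂ = PR a₁ a₂ x₁ x₂. -/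
/-- The Popescu-Rohrlich box: outputs `a₁, a₂` on inputs `x₁, x₂`, with
probability `1/2` on each output pair satisfying `a₁ + a₂ = x₁ * x₂` (mod 2). -/
noncomputable def PRbox (a₁ a₂ x₁ x₂ : ZMod 2) : ℝ :=
  if a₁ + a₂ = x₁ * x₂ then 1 / 2 else 0

/-- The PR box is nonlocal: it cannot be written as a convex combination of
products of local response functions `Q₁(a₁|x₁) Q₂(a₂|x₂)`. -/
theorem PRbox_nonlocal :
    ¬ ∃ (m : ℕ) (p : Fin m → ℝ) (Q₁ Q₂ : Fin m → ZMod 2 → ZMod 2 → ℝ),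
      (∀ l, 0 ≤ p l) ∧ (∑ l, p l = 1) ∧
      (∀ l x a, 0 ≤ Q₁ l x a) ∧ (∀ l x, ∑ a, Q₁ l x a = 1) ∧
      (∀ l x a, 0 ≤ Q₂ l x a) ∧ (∀ l x, ∑ a, Q₂ l x a = 1) ∧
      (∀ a₁ a₂ x₁ x₂ : ZMod 2,
        ∑ l, p l * Q₁ l x₁ a₁ * Q₂ l x₂ a₂ = PRbox a₁ a₂ x₁ x₂) := by
  rintro ⟨m, p, Q₁, Q₂, hp, hs, h1, s1, h2, s2, h⟩
  obtain ⟨l, hl⟩ : ∃ l, p l ≠ 0 := by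
    by_contra hc
    push Not at hc
    simp [hc] at hs
  have key : ∀ a b x y : ZMod 2, a + b ≠ x * y → Q₁ l x a = 0 ∨ Q₂ l y b = 0 := by
    intro a b x y hne
    have h0 := h a b x y
    rw [PRbox, if_neg hne, Finset.sum_eq_zero_iff_of_nonneg
      (fun i _ => mul_nonneg (mul_nonneg (hp i) (h1 i x a)) (h2 i y b))] at h0
    have := h0 l (Finset.mem_univ l)
    simpa [hl] using this
  have t1 : ∀ x, Q₁ l x 0 + Q₁ l x 1 = 1 := fun x => by
    rw [← s1 l x]; exact (Fin.sum_univ_two (Q₁ l x)).symm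
  have t2 : ∀ x, Q₂ l x 0 + Q₂ l x 1 = 1 := fun x => by
    rw [← s2 l x]; exact (Fin.sum_univ_two (Q₂ l x)).symm
  have a0 := t1 0
  have a1 := t1 1
  have b0 := t2 0
  have b1 := t2 1
  have k1 := key 0 1 0 0 (by decide)
  have k2 := key 1 0 0 0 (by decide)
  have k3 := key 0 1 0 1 (by decide)
  have k4 := key 1 0 0 1 (by decide)
  have k5 := key 0 1 1 0 (by decide)
  have k6 := key 1 0 1 0 (by decide)
  have k7 := key 0 0 1 1 (by decide)
  have k8 := key 1 1 1 1 (by decide)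
  clear key t1 t2 h s1 s2 h1 h2 hp hs
  grind
end

section
/- Let μ be any probability mass function on (Fin 5 → ZMod 2) × (Fin 5 → ZMod 2), thought of as a distribution over shared classical randomness that deterministically fixes each party i's outputs a i (for input 0) and a' i (for input 1). Then the μ-probability of the event { (a, a') | (∀ i : Fin 5, a i + a' (i + 1) + a (i + 2) = 0) ∧ (∑ i, a' i = 1) } is 0 (index addition in Fin 5). Consequently, parties sharing only classical random data cannot reproduce, with probability 1, the five cyclic cluster-state constraints a_i + a'_{i+1} + a_{i+2} = 0 (mod 2) together with a'_1 + a'_2 + a'_3 + a'_4 + a'_5 = 1 (mod 2). -/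
/-- Shared classical randomness alone cannot reproduce the five-qubit ring
cluster-state correlations: under any probability mass function `μ` over
deterministic output assignments `(a, a')` (where `a i` is party `i`'s output
for input 0 and `a' i` its output for input 1), the event that the five cyclic
constraints `a i + a' (i+1) + a (i+2) = 0` (mod 2, indices mod 5) and the
constraint `∑ i, a' i = 1` (mod 2) all hold has probability 0. -/
theorem shared_randomness_cluster_event_prob_zero
    (μ : PMF ((Fin 5 → ZMod 2) × (Fin 5 → ZMod 2))) :
    μ.toOuterMeasure
      { p : (Fin 5 → ZMod 2) × (Fin 5 → ZMod 2) |
        (∀ i : Fin 5, p.1 i + p.2 (i + 1) + p.1 (i + 2) = 0) ∧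
        (∑ i, p.2 i = 1) } = 0 := by
  convert MeasureTheory.measure_empty (μ := μ.toOuterMeasure)
  rw [Set.eq_empty_iff_forall_notMem]
  rintro ⟨a, b⟩ ⟨h, hs⟩
  have key : ∑ i : Fin 5, (a i + b (i + 1) + a (i + 2)) = 0 :=
    Finset.sum_eq_zero fun i _ => h i
  have e1 : ∑ i : Fin 5, b (i + 1) = ∑ i, b i := Equiv.sum_comp (Equiv.addRight (1 : Fin 5)) b
  have e2 : ∑ i : Fin 5, a (i + 2) = ∑ i, a i := Equiv.sum_comp (Equiv.addRight (2 : Fin 5)) a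
  have hs' : ∑ i, b i = 1 := hs
  rw [Finset.sum_add_distrib, Finset.sum_add_distrib, e1, e2, hs'] at key
  generalize ∑ i, a i = x at key
  revert x
  decide
end

section
/- Let X₁ and X₂ be nonempty finite input sets, and let NS be the set of functions P : ZMod 2 → ZMod 2 → X₁ → X₂ → ℝ (writing P a₁ a₂ x₁ x₂ for the probability of outputs a₁, a₂ given inputs x₁, x₂) such that: (i) P a₁ a₂ x₁ x₂ ≥ 0; (ii) ∑_{a₁ a₂} P a₁ a₂ x₁ x₂ = 1 for all x₁, x₂; (iii) no-signaling: ∑_{a₂} P a₁ a₂ x₁ x₂ is independent of x₂ (defining the marginal P₁(a₁|x₁)) and ∑_{a₁} P a₁ a₂ x₁ x₂ is independent of x₁ (defining P₂(a₂|x₂)). NS is a convex subset of a finite-dimensional real vector space. Suppose P is an extreme point of NS which is a genuine two-output box, i.e., 0 < P₁(0|x₁) < 1 for every x₁ ∈ X₁ and 0 < P₂(0|x₂) < 1 for every x₂ ∈ X₂. Then P is a bipartite full-correlation box: there exists f : X₁ → X₂ → ZMod 2 such that P a₁ a₂ x₁ x₂ = 1/2 if a₁ + a₂ = f x₁ x₂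 and P a₁ a₂ x₁ x₂ = 0 otherwise. -/
/-- Every extreme point of the set of bipartite no-signaling boxes with binary
outputs that is a *genuine* two-output box (all single-party output marginals
strictly between 0 and 1) is a full-correlation box: there is a function
`f : X₁ → X₂ → ZMod 2` such that `P a₁ a₂ x₁ x₂ = 1/2` if `a₁ + a₂ = f x₁ x₂`
and `0` otherwise. -/
theorem extreme_genuine_two_output_box_is_full_correlation
    (X₁ X₂ : Type) [Fintype X₁] [Fintype X₂] [Nonempty X₁] [Nonempty X₂]
    (NS : Set (ZMod 2 → ZMod 2 → X₁ → X₂ → ℝ))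
    (hNS : NS = { P | (∀ a₁ a₂ x₁ x₂, 0 ≤ P a₁ a₂ x₁ x₂) ∧
        (∀ x₁ x₂, ∑ a₁, ∑ a₂, P a₁ a₂ x₁ x₂ = 1) ∧
        (∀ a₁ x₁ x₂ x₂', ∑ a₂, P a₁ a₂ x₁ x₂ = ∑ a₂, P a₁ a₂ x₁ x₂') ∧
        (∀ a₂ x₂ x₁ x₁', ∑ a₁, P a₁ a₂ x₁ x₂ = ∑ a₁, P a₁ a₂ x₁' x₂) })
    (P : ZMod 2 → ZMod 2 → X₁ → X₂ → ℝ)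
    (hP : P ∈ Set.extremePoints ℝ NS)
    (hgen1 : ∀ x₁ x₂, 0 < ∑ a₂, P 0 a₂ x₁ x₂ ∧ ∑ a₂, P 0 a₂ x₁ x₂ < 1)
    (hgen2 : ∀ x₁ x₂, 0 < ∑ a₁, P a₁ 0 x₁ x₂ ∧ ∑ a₁, P a₁ 0 x₁ x₂ < 1) :
    ∃ f : X₁ → X₂ → ZMod 2, ∀ a₁ a₂ x₁ x₂,
      P a₁ a₂ x₁ x₂ = if a₁ + a₂ = f x₁ x₂ then 1 / 2 else 0 := by
  classical
  have hs : ∀ g : ZMod 2 → ℝ, ∑ a, g a = g 0 + g 1 := fun g => Fin.sum_univ_two g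
  have hz : ∀ a : ZMod 2, a = 0 ∨ a = 1 := by decide
  have h11 : (1 : ZMod 2) + 1 = 0 := by decide
  have h10 : (1 : ZMod 2) ≠ 0 := by decide
  simp only [hs] at hNS hgen1 hgen2
  have hPm : P ∈ NS := hP.1
  have hPm2 := hPm
  rw [hNS] at hPm2
  obtain ⟨hpos, hsum, hn1, hn2⟩ := hPm2
  -- choice of the correlation
  have hf : ∀ x₁ x₂, ∃ b : ZMod 2, ∀ a₁ a₂, a₁ + a₂ = b → 0 < P a₁ a₂ x₁ x₂ := by
    intro x y
    have h1 := hgen1 x y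
    have h2 := hgen2 x y
    have h3 := hsum x y
    have p00 := hpos 0 0 x y
    have p01 := hpos 0 1 x y
    have p10 := hpos 1 0 x y
    have p11 := hpos 1 1 x y
    by_cases hc : 0 < P 0 0 x y ∧ 0 < P 1 1 x y
    · refine ⟨0, fun a b hab => ?_⟩
      rcases hz a with rfl | rfl <;> rcases hz b with rfl | rfl <;> simp_all
    · have hd : 0 < P 0 1 x y ∧ 0 < P 1 0 x y := by
        by_cases h0 : 0 < P 0 0 x y
        · have : ¬ 0 < P 1 1 x y := fun h => hc ⟨h0, h⟩
          constructor <;> linarith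
        · constructor <;> linarith
      refine ⟨1, fun a b hab => ?_⟩
      rcases hz a with rfl | rfl <;> rcases hz b with rfl | rfl <;> simp_all
  choose f hf using hf
  refine ⟨f, ?_⟩
  -- uniform lower bound on the positive entries
  obtain ⟨δ, hδ, hδP⟩ : ∃ δ : ℝ, 0 < δ ∧
      ∀ a₁ a₂ x₁ x₂, 0 < P a₁ a₂ x₁ x₂ → δ ≤ P a₁ a₂ x₁ x₂ := by
    let g : ZMod 2 × ZMod 2 × X₁ × X₂ → ℝ := fun i =>
      if 0 < P i.1 i.2.1 i.2.2.1 i.2.2.2 then P i.1 i.2.1 i.2.2.1 i.2.2.2 else 1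
    obtain ⟨i, hi⟩ := Finite.exists_min g
    refine ⟨g i, ?_, fun a b x y h => ?_⟩
    · simp only [g]
      split_ifs with h
      · exact h
      · exact one_pos
    · have := hi (a, b, x, y)
      simpa only [g, if_pos h] using this
  let F : ZMod 2 → ZMod 2 → X₁ → X₂ → ℝ :=
    fun a b x y => if a + b = f x y then 1 / 2 else 0
  have hFrow : ∀ a x y, F a 0 x y + F a 1 x y = 1 / 2 := by
    intro a x y
    rcases hz a with rfl | rfl <;> rcases hz (f x y) with h | h <;> simp [F, h, h11]
  have hFcol : ∀ a x y, F 0 a x y + F 1 a x y = 1 / 2 := by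
    intro a x y
    rcases hz a with rfl | rfl <;> rcases hz (f x y) with h | h <;> simp [F, h, h11]
  have hF : F ∈ NS := by
    rw [hNS]
    refine ⟨fun a b x y => ?_, fun x y => ?_, fun a x y y' => ?_, fun a x y y' => ?_⟩
    · simp only [F]
      split_ifs <;> norm_num
    · rw [hFrow, hFrow]; norm_num
    · rw [hFrow, hFrow]
    · rw [hFcol, hFcol]
  let Q : ZMod 2 → ZMod 2 → X₁ → X₂ → ℝ :=
    fun a b x y => P a b x y + δ * (P a b x y - F a b x y)
  have hQ : Q ∈ NS := by
    rw [hNS]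
    refine ⟨fun a b x y => ?_, fun x y => ?_, fun a x y y' => ?_, fun a x y y' => ?_⟩
    · have h0 := hpos a b x y
      by_cases h : a + b = f x y
      · have h1 := hδP a b x y (hf x y a b h)
        simp only [Q, F, if_pos h]
        nlinarith
      · simp only [Q, F, if_neg h]
        nlinarith
    · simp only [Q]
      linear_combination (1 + δ) * hsum x y - δ * hFrow 0 x y - δ * hFrow 1 x y
    · simp only [Q]
      linear_combination (1 + δ) * hn1 a x y y' - δ * hFrow a x y + δ * hFrow a x y'
    · simp only [Q]
      linear_combination (1 + δ) * hn2 a x y y' - δ * hFcol a y x + δ * hFcol a y' x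
  have hseg : P ∈ openSegment ℝ F Q := by
    refine ⟨δ / (1 + δ), 1 / (1 + δ), by positivity, by positivity, by field_simp; ring, ?_⟩
    funext a b x y
    simp only [Pi.add_apply, Pi.smul_apply, smul_eq_mul, Q]
    field_simp
    ring
  have hFP : F = P := hP.2 hF hQ hseg
  intro a b x y
  rw [← hFP]
end

section
/- There exists a 5-partite no-signaling box with binary inputs and binary outputs realizing the ring cluster-state correlations: a function P : (Fin 5 → ZMod 2) → (Fin 5 → ZMod 2) → ℝ (writing P a x for the probability of output string a given input string x) such that (i) P a x ≥ 0 and ∑_a P a x = 1 for every x; (ii) no-signaling: for every subset S ⊆ Fin 5, the marginal ∑_{a : a agrees with t on S} P a x depends only on t restricted to S and on x restricted to S; (iii) for every i : Fin 5 and every input x with x i = 0, x (i+1) = 1, x (i+2) = 0 (index addition in Fin 5), P assigns probability 0 to every output a with a i + a (i+1) + a (i+2) ≠ 0; and (iv) for the input x with x i = 1 for all i, P assigns probability 0 to every output a with ∑ i, a i ≠ 1. -/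
/-- Factor: `1` if the pattern is absent, else `2` or `0` by the parity. -/
def cfac (p c : Bool) : ℕ := if p then (if c then 0 else 2) else 1

/-- 32 times the probability, in terms of bits. -/
def cbox (a b c d e v w x y z : Bool) : ℕ :=
  cfac (!v && w && !x) (xor a (xor b c)) *
  cfac (!w && x && !y) (xor b (xor c d)) *
  cfac (!x && y && !z) (xor c (xor d e)) *
  cfac (!y && z && !v) (xor d (xor e a)) *
  cfac (!z && v && !w) (xor e (xor a b)) *
  cfac (!v && w && x && y && !z) (xor a (xor b (xor d e))) *
  cfac (!w && x && y && z && !v) (xor b (xor c (xor e a))) *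
  cfac (!x && y && z && v && !w) (xor c (xor d (xor a b))) *
  cfac (!y && z && v && w && !x) (xor d (xor e (xor b c))) *
  cfac (!z && v && w && x && !y) (xor e (xor a (xor c d))) *
  cfac (v && w && x && y && z) (!(xor a (xor b (xor c (xor d e)))))

set_option maxRecDepth 100000 in
theorem cbox_flip : ∀ v w x y z a b c d e : Bool,
    (cbox a b c d e v w x y z + cbox (!a) b c d e v w x y z
      = cbox a b c d e (!v) w x y z + cbox (!a) b c d e (!v) w x y z) ∧
    (cbox a b c d e v w x y z + cbox a (!b) c d e v w x y z
      = cbox a b c d e v (!w) x y z + cbox a (!b) c d e v (!w) x y z) ∧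
    (cbox a b c d e v w x y z + cbox a b (!c) d e v w x y z
      = cbox a b c d e v w (!x) y z + cbox a b (!c) d e v w (!x) y z) ∧
    (cbox a b c d e v w x y z + cbox a b c (!d) e v w x y z
      = cbox a b c d e v w x (!y) z + cbox a b c (!d) e v w x (!y) z) ∧
    (cbox a b c d e v w x y z + cbox a b c d (!e) v w x y z
      = cbox a b c d e v w x y (!z) + cbox a b c d (!e) v w x y (!z)) := by
  decide +kernel

def zb (u : ZMod 2) : Bool := decide (u = 1)

theorem zb_add_one : ∀ u : ZMod 2, zb (u + 1) = !(zb u) := by decide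

def cN (a x : Fin 5 → ZMod 2) : ℕ :=
  cbox (zb (a 0)) (zb (a 1)) (zb (a 2)) (zb (a 3)) (zb (a 4))
    (zb (x 0)) (zb (x 1)) (zb (x 2)) (zb (x 3)) (zb (x 4))

theorem cN_flip (a x : Fin 5 → ZMod 2) (j : Fin 5) :
    cN a x + cN (a + Pi.single j 1) x
      = cN a (x + Pi.single j 1) + cN (a + Pi.single j 1) (x + Pi.single j 1) := by
  obtain ⟨h0, h1, h2, h3, h4⟩ := cbox_flip (zb (x 0)) (zb (x 1)) (zb (x 2)) (zb (x 3)) (zb (x 4))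
    (zb (a 0)) (zb (a 1)) (zb (a 2)) (zb (a 3)) (zb (a 4))
  fin_cases j
  · simpa [cN, Pi.single_apply, zb_add_one] using h0
  · simpa [cN, Pi.single_apply, zb_add_one] using h1
  · simpa [cN, Pi.single_apply, zb_add_one] using h2
  · simpa [cN, Pi.single_apply, zb_add_one] using h3
  · simpa [cN, Pi.single_apply, zb_add_one] using h4

def cM (S : Finset (Fin 5)) (t x : Fin 5 → ZMod 2) : ℕ :=
  ∑ a ∈ Finset.univ.filter (fun a : Fin 5 → ZMod 2 => ∀ i ∈ S, a i = t i), cN a x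

theorem cM_two (S : Finset (Fin 5)) (t x : Fin 5 → ZMod 2) (j : Fin 5) (hj : j ∉ S) :
    2 * cM S t x = ∑ a ∈ Finset.univ.filter (fun a : Fin 5 → ZMod 2 => ∀ i ∈ S, a i = t i),
      (cN a x + cN (a + Pi.single j 1) x) := by
  rw [Finset.sum_add_distrib, two_mul]
  congr 1
  have key : ∀ a : Fin 5 → ZMod 2, a + Pi.single j 1 + Pi.single j 1 = a := by
    intro a
    rw [add_assoc, CharTwo.add_self_eq_zero, add_zero]
  have hm : ∀ a : Fin 5 → ZMod 2, (∀ i ∈ S, a i = t i) →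
      ∀ i ∈ S, (a + Pi.single j 1 : Fin 5 → ZMod 2) i = t i := by
    intro a ha i hi
    have : i ≠ j := fun h => hj (h ▸ hi)
    simp [this, ha i hi]
  refine Finset.sum_bij' (fun a _ => a + Pi.single j 1) (fun a _ => a + Pi.single j 1)
    ?_ ?_ ?_ ?_ ?_
  · intro a ha
    simpa using hm a (by simpa using ha)
  · intro a ha
    simpa using hm a (by simpa using ha)
  · intro a _
    exact key a
  · intro a _
    exact key a
  · intro a _
    rw [key a]

theorem cM_flip (S : Finset (Fin 5)) (t x : Fin 5 → ZMod 2) (j : Fin 5) (hj : j ∉ S) :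
    cM S t (x + Pi.single j 1) = cM S t x := by
  have h1 := cM_two S t x j hj
  have h2 := cM_two S t (x + Pi.single j 1) j hj
  have : 2 * cM S t (x + Pi.single j 1) = 2 * cM S t x := by
    rw [h1, h2]
    exact Finset.sum_congr rfl fun a _ => (cN_flip a x j).symm
  omega

theorem zmod_two_cases : ∀ u v : ZMod 2, v = u ∨ v = u + 1 := by decide

theorem cM_piecewise (S : Finset (Fin 5)) (t x x' : Fin 5 → ZMod 2)
    (h : ∀ i ∈ S, x i = x' i) (D : Finset (Fin 5)) :
    cM S t (D.piecewise x' x) = cM S t x := by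
  induction D using Finset.induction_on with
  | empty => simp
  | insert j D hjD ih =>
    rw [Finset.piecewise_insert]
    have hD : D.piecewise x' x j = x j := by simp [hjD]
    rcases zmod_two_cases (x j) (x' j) with e | e
    · rw [e, ← hD, Function.update_eq_self, ih]
    · have hj : j ∉ S := by
        intro hj
        have := h j hj
        rw [e] at this
        simp at this
      rw [← ih, ← cM_flip S t (D.piecewise x' x) j hj]
      congr 1
      funext i
      by_cases hi : i = j
      · subst hi
        simp [hjD, e]
      · simp [hi]

theorem cM_nosig (S : Finset (Fin 5)) (t x x' : Fin 5 → ZMod 2)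
    (h : ∀ i ∈ S, x i = x' i) : cM S t x = cM S t x' := by
  have := cM_piecewise S t x x' h Finset.univ
  rw [Finset.piecewise_univ] at this
  exact this.symm

theorem cN_total (x : Fin 5 → ZMod 2) : ∑ a : Fin 5 → ZMod 2, cN a x = 32 := by
  have h := cM_nosig ∅ 0 x 0 (by simp)
  have h0 : ∀ a, cN a 0 = 1 := by
    intro a
    simp [cN, cbox, cfac, zb]
  simp only [cM, h0] at h
  simpa using h

theorem cN_three (i : Fin 5) (x : Fin 5 → ZMod 2)
    (h0 : x i = 0) (h1 : x (i + 1) = 1) (h2 : x (i + 2) = 0)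
    (a : Fin 5 → ZMod 2) (ha : a i + a (i + 1) + a (i + 2) ≠ 0) : cN a x = 0 := by
  have hx : ∀ p q r : ZMod 2, p + q + r ≠ 0 → xor (zb p) (xor (zb q) (zb r)) = true := by decide
  have hz : zb 0 = false := by decide
  have ho : zb 1 = true := by decide
  have hh := hx _ _ _ ha
  fin_cases i <;> simp at h0 h1 h2 hh <;> simp [cN, cbox, h0, h1, h2, hz, ho, hh, cfac]

theorem cN_five (x : Fin 5 → ZMod 2) (h : ∀ i, x i = 1)
    (a : Fin 5 → ZMod 2) (ha : (∑ i, a i) ≠ 1) : cN a x = 0 := by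
  have hx : ∀ p q r s t : ZMod 2, p + q + r + s + t ≠ 1 →
    xor (zb p) (xor (zb q) (xor (zb r) (xor (zb s) (zb t)))) = false := by decide
  have ho : zb 1 = true := by decide
  rw [Fin.sum_univ_five] at ha
  have hh := hx _ _ _ _ _ ha
  simp only [cN, cbox, h, ho, hh]
  simp [cfac]

/-- There exists a 5-partite no-signaling box with binary inputs and outputs
realizing the ring cluster-state correlations: it satisfies with certainty the
cyclic constraints `a i + a (i+1) + a (i+2) = 0` whenever the inputs of parties
`i, i+1, i+2` are `0, 1, 0` (indices mod 5), and `∑ i, a i = 1` when all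
inputs are `1`. -/
theorem exists_cluster_state_no_signaling_box :
    ∃ P : (Fin 5 → ZMod 2) → (Fin 5 → ZMod 2) → ℝ,
      (∀ a x, 0 ≤ P a x) ∧
      (∀ x, ∑ a : Fin 5 → ZMod 2, P a x = 1) ∧
      (∀ (S : Finset (Fin 5)) (t : Fin 5 → ZMod 2) (x x' : Fin 5 → ZMod 2),
        (∀ i ∈ S, x i = x' i) →
        ∑ a ∈ Finset.univ.filter (fun a : Fin 5 → ZMod 2 => ∀ i ∈ S, a i = t i),
            P a x
          = ∑ a ∈ Finset.univ.filter
              (fun a : Fin 5 → ZMod 2 => ∀ i ∈ S, a i = t i), P a x') ∧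
      (∀ (i : Fin 5) (x : Fin 5 → ZMod 2),
        x i = 0 → x (i + 1) = 1 → x (i + 2) = 0 →
        ∀ a : Fin 5 → ZMod 2, a i + a (i + 1) + a (i + 2) ≠ 0 → P a x = 0) ∧
      (∀ x : Fin 5 → ZMod 2, (∀ i, x i = 1) →
        ∀ a : Fin 5 → ZMod 2, (∑ i, a i) ≠ 1 → P a x = 0) := by
  refine ⟨fun a x => (cN a x : ℝ) / 32, ?_, ?_, ?_, ?_, ?_⟩
  · intro a x
    positivity
  · intro x
    rw [← Finset.sum_div, ← Nat.cast_sum, cN_total]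
    norm_num
  · intro S t x x' h
    rw [← Finset.sum_div, ← Finset.sum_div, ← Nat.cast_sum, ← Nat.cast_sum]
    have := cM_nosig S t x x' h
    unfold cM at this
    rw [this]
  · intro i x h0 h1 h2 a ha
    simp [cN_three i x h0 h1 h2 a ha]
  · intro x h a ha
    simp [cN_five x h a ha]
end
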